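/- The reduction relation of the calculus Λ$ is confluent: for all Λ$-terms M, M₁, M₂, if M ↠Λ$ M₁ and M ↠Λ$ M₂, then there exists a Λ$-term N such that M₁ ↠Λ$ N and M₂ ↠Λ$ N. -/

import Mathlib

namespace Shift0

/-! ### The calculus Λ$ (de Bruijn representation) -/

/-- Terms of Λ$: variables, λ-abstractions, freeze `$(M)`, application, thaw `S₀(M)`. -/
inductive Tm : Type
  | var : Nat → Tm
  | lam : Tm → Tm
  | freeze : Tm → Tm
  | app : Tm → Tm → Tm
  | thaw : Tm → Tm
  deriving DecidableEq

namespace Tm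

/-- Values of Λ$: variables, abstractions and frozen terms. -/
inductive IsValue : Tm → Prop
  | var (n : Nat) : IsValue (.var n)
  | lam (M : Tm) : IsValue (.lam M)
  | freeze (M : Tm) : IsValue (.freeze M)

/-- Nonvalues of Λ$: applications and thawed terms. -/
inductive IsNonvalue : Tm → Prop
  | app (M N : Tm) : IsNonvalue (.app M N)
  | thaw (M : Tm) : IsNonvalue (.thaw M)

/-- Boolean value test. -/
def isVal : Tm → Bool
  | .var _ => true
  | .lam _ => true
  | .freeze _ => true
  | .app _ _ => false
  | .thaw _ => false

/-- Lift (shift) the free de Bruijn variables `≥ d` up by one. -/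
def lift (d : Nat) : Tm → Tm
  | .var n => if n < d then .var n else .var (n+1)
  | .lam M => .lam (lift (d+1) M)
  | .freeze M => .freeze (lift d M)
  | .app M N => .app (lift d M) (lift d N)
  | .thaw M => .thaw (lift d M)

/-- Capture-avoiding substitution `M[N/x]` (for the de Bruijn variable `x`);
the variables above `x` are shifted down by one. -/
def subst : Tm → Nat → Tm → Tm
  | .var n, x, N => if n = x then N else if n < x then .var n else .var (n-1)
  | .lam M, x, N => .lam (subst M (x+1) (N.lift 0))
  | .freeze M, x, N => .freeze (subst M x N)
  | .app M L, x, N => .app (subst M x N) (subst L x N)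
  | .thaw M, x, N => .thaw (subst M x N)

/-- `M $ N` is sugar for `$(N) M`. -/
def dol (M N : Tm) : Tm := .app (.freeze N) M

/-- `let x = M in N` is sugar for `S₀k.((λx.(k $ N)) $ M)`;
here `N` has the let-bound variable as de Bruijn index `0`. -/
def letIn (M N : Tm) : Tm :=
  .thaw (.lam (dol (.lam (dol (.var 1) (N.lift 1))) (M.lift 0)))

end Tm

/-- Bindable contexts `J ::= [] M | V [] | S₀([])`. -/
inductive JCtx : Type
  | appL : Tm → JCtx
  | appR : Tm → JCtx
  | thaw : JCtx

namespace JCtx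

/-- Well-formedness: in `V []` the term `V` must be a value. -/
def Wf : JCtx → Prop
  | .appL _ => True
  | .appR V => V.IsValue
  | .thaw => True

/-- Plugging a term into a bindable context. -/
def plug : JCtx → Tm → Tm
  | .appL N, M => .app M N
  | .appR V, M => .app V M
  | .thaw, M => .thaw M

/-- Lift the free variables `≥ d` of a bindable context. -/
def lift (d : Nat) : JCtx → JCtx
  | .appL N => .appL (N.lift d)
  | .appR V => .appR (V.lift d)
  | .thaw => .thaw

end JCtx

/-- Pure contexts `K ::= [] | J[K]`, represented as a list of bindable
contexts (head outermost). -/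
abbrev KCtx : Type := List JCtx

/-- Plugging a term into a pure context. -/
def KCtx.plug : KCtx → Tm → Tm
  | [], M => M
  | (J :: K), M => J.plug (KCtx.plug K M)

/-- Well-formedness of a pure context. -/
def KCtx.Wf (K : KCtx) : Prop := ∀ J ∈ K, JCtx.Wf J

/-- Lift the free variables `≥ d` of a pure context. -/
def KCtx.lift (d : Nat) (K : KCtx) : KCtx := K.map (JCtx.lift d)

namespace Tm

/-- The basic contractions of Λ$. -/
inductive Contr : Tm → Tm → Prop
  | betav (M V : Tm) : V.IsValue → Contr (.app (.lam M) V) (M.subst 0 V)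
  | etav (V : Tm) : V.IsValue → Contr (.lam (.app (V.lift 0) (.var 0))) V
  | dolv (V : Tm) : V.IsValue → Contr (.freeze V) (.lam (.app (.var 0) (V.lift 0)))
  | dolsh (V : Tm) : V.IsValue → Contr (.freeze (.thaw V)) V
  | shdol (M : Tm) : Contr (.thaw (.freeze M)) M
  | pure (V : Tm) : V.IsValue → Contr (.thaw (.lam (.app (.var 0) (V.lift 0)))) V
  | bind (J : JCtx) (P : Tm) : J.Wf → P.IsNonvalue →
      Contr (J.plug P) (letIn P ((J.lift 0).plug (.var 0)))

/-- One-step reduction of Λ$: closure of the contractions under arbitrary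
contexts (including under binders). -/
inductive Step : Tm → Tm → Prop
  | contr {M N : Tm} : Contr M N → Step M N
  | lam {M N : Tm} : Step M N → Step (.lam M) (.lam N)
  | freeze {M N : Tm} : Step M N → Step (.freeze M) (.freeze N)
  | appL {M N L : Tm} : Step M N → Step (.app M L) (.app N L)
  | appR {M N L : Tm} : Step M N → Step (.app L M) (.app L N)
  | thaw {M N : Tm} : Step M N → Step (.thaw M) (.thaw N)

/-- Multi-step reduction `↠Λ$`. -/
def Steps : Tm → Tm → Prop := Relation.ReflTransGen Step

/-- Convertibility `=Λ$`: the equivalence generated by reduction. -/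
def Equiv : Tm → Tm → Prop := Relation.EqvGen Step

end Tm

/-! ### The pure λ-calculus with βη -/

/-- Terms of the pure λ-calculus. -/
inductive Lam : Type
  | var : Nat → Lam
  | lam : Lam → Lam
  | app : Lam → Lam → Lam
  deriving DecidableEq

namespace Lam

/-- Lift the free de Bruijn variables `≥ d` up by one. -/
def lift (d : Nat) : Lam → Lam
  | .var n => if n < d then .var n else .var (n+1)
  | .lam M => .lam (lift (d+1) M)
  | .app M N => .app (lift d M) (lift d N)

/-- Capture-avoiding substitution `M[N/x]`. -/
def subst : Lam → Nat → Lam → Lam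
  | .var n, x, N => if n = x then N else if n < x then .var n else .var (n-1)
  | .lam M, x, N => .lam (subst M (x+1) (N.lift 0))
  | .app M L, x, N => .app (subst M x N) (subst L x N)

/-- β and η contractions. -/
inductive Contr : Lam → Lam → Prop
  | beta (M N : Lam) : Contr (.app (.lam M) N) (M.subst 0 N)
  | eta (M : Lam) : Contr (.lam (.app (M.lift 0) (.var 0))) M

/-- One-step βη-reduction, closed under arbitrary contexts. -/
inductive Step : Lam → Lam → Prop
  | contr {M N : Lam} : Contr M N → Step M N
  | lam {M N : Lam} : Step M N → Step (.lam M) (.lam N)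
  | appL {M N L : Lam} : Step M N → Step (.app M L) (.app N L)
  | appR {M N L : Lam} : Step M N → Step (.app L M) (.app L N)

/-- Multi-step βη-reduction `↠λ`. -/
def Steps : Lam → Lam → Prop := Relation.ReflTransGen Step

/-- βη-convertibility `=λ`. -/
def Equiv : Lam → Lam → Prop := Relation.EqvGen Step

end Lam

end Shift0

namespace Shift0

/-! ### The CPS translation `* : Λ$ → λ` and its value part `†` -/

mutual

/-- The CPS translation `M*`.  It is the full unfolding of the equations
`V* = λk.k V†`, `J[P]* = λk.P* (λx.(J[x]* k))`, `(V W)* = V† W†` and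
`(S₀(V))* = V†`. -/
def cps : Tm → Lam
  | .var n => .lam (.app (.var 0) (.var (n+1)))
  | .lam M => .lam (.app (.var 0) ((Lam.lam (cps M)).lift 0))
  | .freeze M => .lam (.app (.var 0) ((cps M).lift 0))
  | .app M N =>
      if M.isVal then
        if N.isVal then .app (cpsV M) (cpsV N)
        else
          .lam (.app ((cps N).lift 0)
            (.lam (.app (.app (((cpsV M).lift 0).lift 0) (.var 0)) (.var 1))))
      else
        if N.isVal then
          .lam (.app ((cps M).lift 0)
            (.lam (.app (.app (.var 0) (((cpsV N).lift 0).lift 0)) (.var 1))))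
        else
          .lam (.app ((cps M).lift 0)
            (.lam (.app
              (.lam (.app ((((cps N).lift 0).lift 0).lift 0)
                (.lam (.app (.app (.var 2) (.var 0)) (.var 1)))))
              (.var 1))))
  | .thaw M =>
      if M.isVal then cpsV M
      else .lam (.app ((cps M).lift 0) (.lam (.app (.var 0) (.var 1))))

/-- The value part `V†` of the CPS translation (junk on nonvalues). -/
def cpsV : Tm → Lam
  | .var n => .var n
  | .lam M => .lam (cps M)
  | .freeze M => cps M
  | .app _ _ => .var 0
  | .thaw _ => .var 0

end

/-! ### The direct-style translation `# : λ → Λ$` and its auxiliary `♮` -/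

namespace Lam

/-- Does the de Bruijn variable `x` occur free in the term? -/
def hasVar (x : Nat) : Lam → Bool
  | .var n => n = x
  | .lam M => hasVar (x+1) M
  | .app M N => hasVar x M || hasVar x N

/-- Shift the free de Bruijn variables `> d` down by one
(inverse of `lift d` on terms not containing `d` free). -/
def lower (d : Nat) : Lam → Lam
  | .var n => if d < n then .var (n-1) else .var n
  | .lam M => .lam (lower (d+1) M)
  | .app M N => .app (lower d M) (lower d N)

/-- Size of a λ-term. -/
def size : Lam → Nat
  | .var _ => 1
  | .lam M => size M + 1
  | .app M N => size M + size N + 1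

theorem size_lower (d : Nat) (M : Lam) : (lower d M).size = M.size := by
  induction M generalizing d with
  | var n => simp only [lower]; split <;> rfl
  | lam M ih => simp [lower, size, ih]
  | app M N ihM ihN => simp [lower, size, ihM, ihN]

end Lam

mutual

/-- The direct-style translation `M#`; the case `(λx.x N)# = N♮` (with
`x ∉ FV(N)`) is rendered by checking that de Bruijn variable `0` does not
occur in `N` and lowering the remaining variables. -/
def ds : Lam → Tm
  | .var n => .thaw (.var n)
  | .app M N => .app (nat M) (nat N)
  | .lam (.app (.var 0) N) =>
      if N.hasVar 0 then .thaw (.lam (.app (.var 0) (nat N)))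
      else nat (N.lower 0)
  | .lam M => .thaw (.lam (ds M))
termination_by M => M.size
decreasing_by all_goals simp [Lam.size, Lam.size_lower] <;> omega

/-- The auxiliary direct-style translation `M♮`. -/
def nat : Lam → Tm
  | .var n => .var n
  | .lam M => .lam (ds M)
  | .app M N => .freeze (.app (nat M) (nat N))
termination_by M => M.size
decreasing_by all_goals simp [Lam.size, Lam.size_lower] <;> omega

end

end Shift0

namespace Shift0

/-! ### Materzok's calculus λ$ -/

/-- Terms of λ$: variables, abstractions, applications, `S₀x.e`
(the body is under a binder) and `e $ e'`. -/
inductive LTm : Type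
  | var : Nat → LTm
  | lam : LTm → LTm
  | app : LTm → LTm → LTm
  | shift : LTm → LTm
  | dollar : LTm → LTm → LTm
  deriving DecidableEq

namespace LTm

/-- Values of λ$: variables and abstractions. -/
inductive IsValue : LTm → Prop
  | var (n : Nat) : IsValue (.var n)
  | lam (e : LTm) : IsValue (.lam e)

/-- Lift the free de Bruijn variables `≥ d` up by one. -/
def lift (d : Nat) : LTm → LTm
  | .var n => if n < d then .var n else .var (n+1)
  | .lam e => .lam (lift (d+1) e)
  | .app e f => .app (lift d e) (lift d f)
  | .shift e => .shift (lift (d+1) e)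
  | .dollar e f => .dollar (lift d e) (lift d f)

/-- Capture-avoiding substitution `e[v/x]`. -/
def subst : LTm → Nat → LTm → LTm
  | .var n, x, N => if n = x then N else if n < x then .var n else .var (n-1)
  | .lam e, x, N => .lam (subst e (x+1) (N.lift 0))
  | .app e f, x, N => .app (subst e x N) (subst f x N)
  | .shift e, x, N => .shift (subst e (x+1) (N.lift 0))
  | .dollar e f, x, N => .dollar (subst e x N) (subst f x N)

end LTm

/-- Pure contexts of λ$: `E ::= [] | E e | v E | E $ e`. -/
inductive ECtx : Type
  | hole : ECtx
  | appL : ECtx → LTm → ECtx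
  | appR : LTm → ECtx → ECtx
  | dolL : ECtx → LTm → ECtx

namespace ECtx

/-- Well-formedness: in `v E` the term `v` must be a value. -/
def Wf : ECtx → Prop
  | .hole => True
  | .appL E _ => E.Wf
  | .appR v E => v.IsValue ∧ E.Wf
  | .dolL E _ => E.Wf

/-- Plugging a term into a pure context of λ$. -/
def plug : ECtx → LTm → LTm
  | .hole, e => e
  | .appL E f, e => .app (E.plug e) f
  | .appR v E, e => .app v (E.plug e)
  | .dolL E f, e => .dollar (E.plug e) f

/-- Lift the free variables `≥ d` of a pure context. -/
def lift (d : Nat) : ECtx → ECtx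
  | .hole => .hole
  | .appL E f => .appL (E.lift d) (f.lift d)
  | .appR v E => .appR (v.lift d) (E.lift d)
  | .dolL E f => .dolL (E.lift d) (f.lift d)

end ECtx

namespace LTm

/-- The axioms of λ$. -/
inductive Ax : LTm → LTm → Prop
  | betav (e v : LTm) : v.IsValue → Ax (.app (.lam e) v) (e.subst 0 v)
  | etav (v : LTm) : v.IsValue → Ax (.lam (.app (v.lift 0) (.var 0))) v
  | dolv (v w : LTm) : v.IsValue → w.IsValue → Ax (.dollar v w) (.app v w)
  | dolE (v : LTm) (E : ECtx) (e : LTm) : v.IsValue → E.Wf →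
      Ax (.dollar v (E.plug e))
         (.dollar (.lam (.dollar (v.lift 0) ((E.lift 0).plug (.var 0)))) e)
  | betad (v e : LTm) : v.IsValue → Ax (.dollar v (.shift e)) (e.subst 0 v)
  | etad (e : LTm) : Ax (.shift (.dollar (.var 0) (e.lift 0))) e

/-- The axioms applied in an arbitrary context. -/
inductive AStep : LTm → LTm → Prop
  | ax {e f : LTm} : Ax e f → AStep e f
  | lam {e f : LTm} : AStep e f → AStep (.lam e) (.lam f)
  | appL {e f g : LTm} : AStep e f → AStep (.app e g) (.app f g)
  | appR {e f g : LTm} : AStep e f → AStep (.app g e) (.app g f)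
  | shift {e f : LTm} : AStep e f → AStep (.shift e) (.shift f)
  | dolL {e f g : LTm} : AStep e f → AStep (.dollar e g) (.dollar f g)
  | dolR {e f g : LTm} : AStep e f → AStep (.dollar g e) (.dollar g f)

/-- The equational theory `=λ$` generated by the axioms. -/
def Equiv : LTm → LTm → Prop := Relation.EqvGen AStep

end LTm

/-- The embedding `ι : λ$ → Λ$`. -/
def iota : LTm → Tm
  | .var n => .var n
  | .lam e => .lam (iota e)
  | .app e f => .app (iota e) (iota f)
  | .shift e => .thaw (.lam (iota e))
  | .dollar e f => .app (.freeze (iota f)) (iota e)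

/-- The translation `π : Λ$ → λ$`. -/
def pi : Tm → LTm
  | .var n => .var n
  | .lam M => .lam (pi M)
  | .freeze M => .lam (.dollar (.var 0) ((pi M).lift 0))
  | .app M N => .app (pi M) (pi N)
  | .thaw M => .app (.lam (.shift (.app (.var 1) (.var 0)))) (pi M)

/-- Materzok's CPS translation `⟦·⟧ : λ$ → λ` (with the value translation
`⟪x⟫ = x`, `⟪λx.e⟫ = λx.⟦e⟧` inlined). -/
def mcps : LTm → Lam
  | .var n => .lam (.app (.var 0) (.var (n+1)))
  | .lam e => .lam (.app (.var 0) ((Lam.lam (mcps e)).lift 0))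
  | .app e f => .lam (.app ((mcps e).lift 0)
      (.lam (.app (((mcps f).lift 0).lift 0)
        (.lam (.app (.app (.var 1) (.var 0)) (.var 2))))))
  | .shift e => .lam (mcps e)
  | .dollar e f => .lam (.app ((mcps e).lift 0)
      (.lam (.app (.app (((mcps f).lift 0).lift 0) (.var 0)) (.var 1))))

end Shift0

namespace Shift0

section Relation

variable {α β : Type*} {r : α → α → Prop} {p : β → β → Prop} {a b : α}

theorem reflGen_map (f : α → β) (h : Relation.ReflGen r a b)
    (hf : ∀ a b, r a b → p (f a) (f b)) : Relation.ReflGen p (f a) (f b) := by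
  cases h with
  | refl => exact .refl
  | single h => exact .single (hf _ _ h)

theorem rtc_bind {f : α → β} (h : Relation.ReflTransGen r a b)
    (hf : ∀ a b, r a b → Relation.ReflTransGen p (f a) (f b)) :
    Relation.ReflTransGen p (f a) (f b) := by
  induction h with
  | refl => exact .refl
  | tail _ h ih => exact ih.trans (hf _ _ h)

theorem rtc_map (f : α → β) (h : Relation.ReflTransGen r a b)
    (hf : ∀ a b, r a b → p (f a) (f b)) : Relation.ReflTransGen p (f a) (f b) :=
  rtc_bind h fun _ _ h => .single (hf _ _ h)

end Relation

/-! ### Substitution calculus of the pure λ-calculus -/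

namespace Lam

theorem lift_lift (M : Lam) {i d : Nat} (h : i ≤ d) :
    (M.lift i).lift (d + 1) = (M.lift d).lift i := by
  induction M generalizing i d with
  | var n => grind [lift]
  | lam M ih => simp only [lift, ih (Nat.succ_le_succ h)]
  | app M N ihM ihN => simp only [lift, ihM h, ihN h]

@[simp] theorem lift_zero_lift_succ (M : Lam) (d : Nat) :
    (M.lift 0).lift (d + 1) = (M.lift d).lift 0 := lift_lift M (Nat.zero_le d)

@[simp] theorem subst_lift_self (M N : Lam) (d : Nat) : (M.lift d).subst d N = M := by
  induction M generalizing d N with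
  | var n => grind [lift, subst]
  | lam M ih => simp only [lift, subst, ih]
  | app M L ihM ihL => simp only [lift, subst, ihM, ihL]

theorem lift_injective {M N : Lam} {d : Nat} (h : M.lift d = N.lift d) : M = N := by
  rw [← subst_lift_self M M d, h, subst_lift_self]

@[simp] theorem lift_succ_subst_var (M : Lam) (d : Nat) :
    (M.lift (d + 1)).subst d (.var d) = M := by
  induction M generalizing d with
  | var n => grind [lift, subst]
  | lam M ih => simpa [lift, subst] using ih (d + 1)
  | app M L ihM ihL => simp only [lift, subst, ihM, ihL]

theorem lift_subst_of_le (M N : Lam) {i x : Nat} (h : i ≤ x) :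
    (M.lift i).subst (x + 1) (N.lift i) = (M.subst x N).lift i := by
  induction M generalizing i x N with
  | var n => grind [lift, subst]
  | lam M ih =>
    simp only [lift, subst, ← lift_lift N (Nat.zero_le i), ih _ (Nat.succ_le_succ h)]
  | app M L ihM ihL => simp only [lift, subst, ihM _ h, ihL _ h]

@[simp] theorem lift_zero_subst_succ (M N : Lam) (x : Nat) :
    (M.lift 0).subst (x + 1) (N.lift 0) = (M.subst x N).lift 0 :=
  lift_subst_of_le M N (Nat.zero_le x)

theorem lift_subst_of_ge (M N : Lam) {x d : Nat} (h : x ≤ d) :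
    (M.subst x N).lift d = (M.lift (d + 1)).subst x (N.lift d) := by
  induction M generalizing x d N with
  | var n => grind [lift, subst]
  | lam M ih => simp only [lift, subst, ih _ (Nat.succ_le_succ h), lift_zero_lift_succ]
  | app M L ihM ihL => simp only [lift, subst, ihM _ h, ihL _ h]

theorem subst_subst (M N L : Lam) {x y : Nat} (h : x ≤ y) :
    (M.subst x N).subst y L = (M.subst (y + 1) (L.lift x)).subst x (N.subst y L) := by
  induction M generalizing x y N L with
  | var n => grind [subst, subst_lift_self]
  | lam M ih =>
    simp only [subst, ih _ _ (Nat.succ_le_succ h), lift_zero_lift_succ, lift_zero_subst_succ]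
  | app M K ihM ihK => simp only [subst, ihM _ _ h, ihK _ _ h]

theorem exists_of_lift_eq_lift {M N : Lam} {i d : Nat} (h : i ≤ d)
    (e : M.lift (d + 1) = N.lift i) : ∃ K : Lam, M = K.lift i ∧ N = K.lift d := by
  induction M generalizing N i d with
  | var n =>
    cases N with
    | var m =>
      refine ⟨.var (if n < i then n else n - 1), ?_⟩
      grind [lift]
    | _ => grind [lift]
  | lam M ih =>
    cases N with
    | lam N =>
      obtain ⟨K, rfl, rfl⟩ := ih (Nat.succ_le_succ h) (Lam.lam.inj e)
      exact ⟨.lam K, rfl, rfl⟩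
    | _ => grind [lift]
  | app M L ihM ihL =>
    cases N with
    | app N O =>
      obtain ⟨eM, eL⟩ := Lam.app.inj e
      obtain ⟨K, rfl, rfl⟩ := ihM h eM
      obtain ⟨K', rfl, rfl⟩ := ihL h eL
      exact ⟨.app K K', rfl, rfl⟩
    | _ => grind [lift]

@[simp] theorem size_lift (M : Lam) (d : Nat) : (M.lift d).size = M.size := by
  induction M generalizing d with
  | var n => simp only [lift]; split <;> rfl
  | lam M ih => simp [lift, size, ih]
  | app M N ihM ihN => simp [lift, size, ihM, ihN]

/-! ### β- and η-reduction, separately -/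

/-- Closure of a relation on λ-terms under arbitrary contexts. -/
inductive Compat (C : Lam → Lam → Prop) : Lam → Lam → Prop
  | contr {M N : Lam} : C M N → Compat C M N
  | lam {M N : Lam} : Compat C M N → Compat C (.lam M) (.lam N)
  | appL {M N L : Lam} : Compat C M N → Compat C (.app M L) (.app N L)
  | appR {M N L : Lam} : Compat C M N → Compat C (.app L M) (.app L N)

/-- β-contraction. -/
inductive BetaC : Lam → Lam → Prop
  | mk (M N : Lam) : BetaC (.app (.lam M) N) (M.subst 0 N)

/-- η-contraction. -/
inductive EtaC : Lam → Lam → Prop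
  | mk (M : Lam) : EtaC (.lam (.app (M.lift 0) (.var 0))) M

/-- One-step β-reduction. -/
abbrev Beta : Lam → Lam → Prop := Compat BetaC

/-- One-step η-reduction. -/
abbrev Eta : Lam → Lam → Prop := Compat EtaC

theorem contr_iff {M N : Lam} : Contr M N ↔ BetaC M N ∨ EtaC M N := by
  constructor
  · rintro (⟨M, N⟩ | ⟨M⟩)
    exacts [.inl ⟨_, _⟩, .inr ⟨_⟩]
  · rintro (h | h)
    · cases h; exact .beta _ _
    · cases h; exact .eta N

theorem step_iff {M N : Lam} : Step M N ↔ Beta M N ∨ Eta M N := by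
  constructor
  · intro h
    induction h with
    | contr h => exact (contr_iff.1 h).imp .contr .contr
    | lam _ ih => exact ih.imp .lam .lam
    | appL _ ih => exact ih.imp .appL .appL
    | appR _ ih => exact ih.imp .appR .appR
  · rintro (h | h)
    all_goals
      induction h with
      | contr h => exact .contr (contr_iff.2 (by simp [h]))
      | lam _ ih => exact .lam ih
      | appL _ ih => exact .appL ih
      | appR _ ih => exact .appR ih

namespace Compat

variable {C : Lam → Lam → Prop}

theorem rtc_lam {M N : Lam} (h : Relation.ReflTransGen (Compat C) M N) :
    Relation.ReflTransGen (Compat C) (.lam M) (.lam N) :=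
  rtc_map _ h fun _ _ => .lam

theorem rtc_app {M M' N N' : Lam} (h : Relation.ReflTransGen (Compat C) M M')
    (h' : Relation.ReflTransGen (Compat C) N N') :
    Relation.ReflTransGen (Compat C) (.app M N) (.app M' N') :=
  (rtc_map (Lam.app · N) h fun _ _ => .appL).trans (rtc_map (Lam.app M' ·) h' fun _ _ => .appR)

theorem lift (hC : ∀ M N d, C M N → C (M.lift d) (N.lift d)) {M N : Lam} (h : Compat C M N)
    (d : Nat) : Compat C (M.lift d) (N.lift d) := by
  induction h generalizing d with
  | contr h => exact .contr (hC _ _ d h)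
  | lam _ ih => exact .lam (ih _)
  | appL _ ih => exact .appL (ih _)
  | appR _ ih => exact .appR (ih _)

theorem of_lift (hC : ∀ M N d, C (Lam.lift d M) N → ∃ N' : Lam, N = N'.lift d ∧ C M N')
    {M N : Lam} {d : Nat} (h : Compat C (M.lift d) N) :
    ∃ N' : Lam, N = N'.lift d ∧ Compat C M N' := by
  generalize e : M.lift d = L at h
  induction h generalizing M d with
  | contr h =>
    subst e
    obtain ⟨N', e, h⟩ := hC _ _ _ h
    exact ⟨N', e, .contr h⟩
  | lam _ ih =>
    cases M with
    | lam M =>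
      obtain ⟨N', rfl, h⟩ := ih (Lam.lam.inj e)
      exact ⟨.lam N', rfl, .lam h⟩
    | _ => grind [Lam.lift]
  | appL _ ih =>
    cases M with
    | app M L =>
      simp only [Lam.lift, Lam.app.injEq] at e
      obtain ⟨e, rfl⟩ := e
      obtain ⟨N', rfl, h⟩ := ih e
      exact ⟨.app N' L, rfl, .appL h⟩
    | _ => grind [Lam.lift]
  | appR _ ih =>
    cases M with
    | app M L =>
      simp only [Lam.lift, Lam.app.injEq] at e
      obtain ⟨rfl, e⟩ := e
      obtain ⟨N', rfl, h⟩ := ih e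
      exact ⟨.app M N', rfl, .appR h⟩
    | _ => grind [Lam.lift]

end Compat

theorem BetaC.lift {M N : Lam} (h : BetaC M N) (d : Nat) : BetaC (M.lift d) (N.lift d) := by
  obtain ⟨M, N⟩ := h
  rw [lift_subst_of_ge M N (Nat.zero_le d)]
  exact ⟨_, _⟩

theorem EtaC.lift {M N : Lam} (h : EtaC M N) (d : Nat) : EtaC (M.lift d) (N.lift d) := by
  obtain ⟨M⟩ := h
  simpa [Lam.lift] using EtaC.mk (N.lift d)

theorem BetaC.of_lift {M N : Lam} {d : Nat} (h : BetaC (M.lift d) N) :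
    ∃ N' : Lam, N = N'.lift d ∧ BetaC M N' := by
  generalize e : M.lift d = L at h
  obtain ⟨A, B⟩ := h
  cases M with
  | app M K =>
    obtain ⟨e, rfl⟩ := Lam.app.inj e
    cases M with
    | lam M =>
      cases e
      exact ⟨_, (lift_subst_of_ge M K (Nat.zero_le d)).symm, ⟨_, _⟩⟩
    | _ => grind [Lam.lift]
  | _ => grind [Lam.lift]

theorem EtaC.of_lift {M N : Lam} {d : Nat} (h : EtaC (M.lift d) N) :
    ∃ N' : Lam, N = N'.lift d ∧ EtaC M N' := by
  generalize e : M.lift d = L at h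
  obtain ⟨A⟩ := h
  cases M with
  | lam M =>
    have e := Lam.lam.inj e
    cases M with
    | app M K =>
      obtain ⟨e, e'⟩ := Lam.app.inj e
      obtain ⟨K', rfl, rfl⟩ := exists_of_lift_eq_lift (Nat.zero_le d) e
      cases K with
      | var n =>
        obtain rfl : n = 0 := by grind [Lam.lift]
        exact ⟨K', rfl, ⟨_⟩⟩
      | _ => grind [Lam.lift]
    | _ => grind [Lam.lift]
  | _ => grind [Lam.lift]

theorem Beta.lift {M N : Lam} (h : Beta M N) (d : Nat) : Beta (M.lift d) (N.lift d) :=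
  Compat.lift (fun _ _ d h => h.lift d) h d

theorem Eta.lift {M N : Lam} (h : Eta M N) (d : Nat) : Eta (M.lift d) (N.lift d) :=
  Compat.lift (fun _ _ d h => h.lift d) h d

theorem Beta.of_lift {M N : Lam} {d : Nat} (h : Beta (M.lift d) N) :
    ∃ N' : Lam, N = N'.lift d ∧ Beta M N' :=
  Compat.of_lift (fun _ _ _ h => h.of_lift) h

theorem Eta.of_lift {M N : Lam} {d : Nat} (h : Eta (M.lift d) N) :
    ∃ N' : Lam, N = N'.lift d ∧ Eta M N' :=
  Compat.of_lift (fun _ _ _ h => h.of_lift) h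

theorem Eta.subst_left {M M' : Lam} (h : Eta M M') (x : Nat) (N : Lam) :
    Eta (M.subst x N) (M'.subst x N) := by
  induction h generalizing x N with
  | contr h =>
    obtain ⟨M⟩ := h
    refine .contr ?_
    simpa [subst] using EtaC.mk (Lam.subst _ x N)
  | lam _ ih => exact .lam (ih _ _)
  | appL _ ih => exact .appL (ih _ _)
  | appR _ ih => exact .appR (ih _ _)

theorem Eta.subst_right {N N' : Lam} (h : Eta N N') (x : Nat) (M : Lam) :
    Relation.ReflTransGen Eta (M.subst x N) (M.subst x N') := by
  induction M generalizing x N N' with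
  | var n =>
    simp only [subst]
    split_ifs
    exacts [.single h, .refl, .refl]
  | lam M ih => exact Compat.rtc_lam (ih (Eta.lift h 0) _)
  | app M L ihM ihL => exact Compat.rtc_app (ihM h _) (ihL h _)

/-! ### Confluence of η, and commutation of β with η -/

theorem Eta.subcommute {M N L : Lam} (h : Eta M N) (h' : Eta M L) :
    ∃ Q, Relation.ReflGen Eta N Q ∧ Relation.ReflGen Eta L Q := by
  have key : ∀ {K L : Lam}, Eta (.lam (.app (K.lift 0) (.var 0))) L →
      ∃ Q, Relation.ReflGen Eta K Q ∧ Relation.ReflGen Eta L Q := by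
    intro K L h
    generalize e : Lam.lam (.app (K.lift 0) (.var 0)) = A at h
    cases h with
    | contr h =>
      obtain ⟨K'⟩ := h
      simp only [Lam.lam.injEq, Lam.app.injEq, and_true] at e
      obtain rfl := lift_injective e
      exact ⟨_, .refl, .refl⟩
    | lam h =>
      obtain rfl := Lam.lam.inj e
      cases h with
      | contr h => nomatch h
      | appL h =>
        obtain ⟨N', rfl, h'⟩ := Eta.of_lift h
        exact ⟨N', .single h', .single (.contr ⟨_⟩)⟩
      | appR h => cases h with | contr h => nomatch h
    | appL h => nomatch e
    | appR h => nomatch e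
  induction h generalizing L with
  | contr h =>
    obtain ⟨K⟩ := h
    exact key h'
  | lam h ih =>
    cases h' with
    | contr h' =>
      obtain ⟨K⟩ := h'
      obtain ⟨Q, h₁, h₂⟩ := key (.lam h)
      exact ⟨Q, h₂, h₁⟩
    | lam h' =>
      obtain ⟨Q, h₁, h₂⟩ := ih h'
      exact ⟨.lam Q, reflGen_map _ h₁ fun _ _ => .lam, reflGen_map _ h₂ fun _ _ => .lam⟩
  | @appL _ _ K h ih =>
    cases h' with
    | contr h' => nomatch h'
    | appL h' =>
      obtain ⟨Q, h₁, h₂⟩ := ih h'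
      exact ⟨.app Q K, reflGen_map (Lam.app · K) h₁ fun _ _ => .appL,
        reflGen_map (Lam.app · K) h₂ fun _ _ => .appL⟩
    | appR h' => exact ⟨_, .single (.appR h'), .single (.appL h)⟩
  | @appR _ _ K h ih =>
    cases h' with
    | contr h' => nomatch h'
    | appR h' =>
      obtain ⟨Q, h₁, h₂⟩ := ih h'
      exact ⟨.app K Q, reflGen_map _ h₁ fun _ _ => .appR, reflGen_map _ h₂ fun _ _ => .appR⟩
    | appL h' => exact ⟨_, .single (.appL h'), .single (.appR h)⟩

theorem Beta.commute_eta {M N L : Lam} (h : Beta M N) (h' : Eta M L) :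
    ∃ Q, Relation.ReflTransGen Eta N Q ∧ Relation.ReflGen Beta L Q := by
  induction h generalizing L with
  | contr h =>
    obtain ⟨A, B⟩ := h
    cases h' with
    | contr h' => nomatch h'
    | appL h' =>
      cases h' with
      | contr h' =>
        obtain ⟨K⟩ := h'
        simp only [subst, subst_lift_self, if_true]
        exact ⟨_, .refl, .refl⟩
      | lam h' => exact ⟨_, .single (Eta.subst_left h' 0 B), .single (.contr ⟨_, _⟩)⟩
    | appR h' => exact ⟨_, Eta.subst_right h' 0 A, .single (.contr ⟨_, _⟩)⟩
  | lam h ih =>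
    cases h' with
    | contr h' =>
      generalize e : Lam.lam _ = A at h'
      obtain ⟨K⟩ := h'
      obtain rfl := Lam.lam.inj e
      generalize e' : Lam.app _ _ = B at h
      cases h with
      | contr h =>
        obtain ⟨A, B⟩ := h
        simp only [Lam.app.injEq] at e'
        obtain ⟨e', rfl⟩ := e'
        cases L with
        | lam L =>
          obtain rfl := Lam.lam.inj e'
          simp only [Nat.zero_add, lift_succ_subst_var]
          exact ⟨_, .refl, .refl⟩
        | _ => grind [Lam.lift]
      | lam h => nomatch e'
      | appL h =>
        obtain ⟨rfl, rfl⟩ := Lam.app.inj e'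
        obtain ⟨N', rfl, h'⟩ := Beta.of_lift h
        exact ⟨N', .single (.contr ⟨_⟩), .single h'⟩
      | appR h =>
        obtain ⟨rfl, rfl⟩ := Lam.app.inj e'
        cases h with | contr h => nomatch h
    | lam h' =>
      obtain ⟨Q, h₁, h₂⟩ := ih h'
      exact ⟨.lam Q, Compat.rtc_lam h₁, reflGen_map _ h₂ fun _ _ => .lam⟩
  | @appL _ _ K h ih =>
    cases h' with
    | contr h' => nomatch h'
    | appL h' =>
      obtain ⟨Q, h₁, h₂⟩ := ih h'
      exact ⟨.app Q K, Compat.rtc_app h₁ .refl,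
        reflGen_map (Lam.app · K) h₂ fun _ _ => .appL⟩
    | appR h' => exact ⟨_, .single (.appR h'), .single (.appL h)⟩
  | @appR _ _ K h ih =>
    cases h' with
    | contr h' => nomatch h'
    | appR h' =>
      obtain ⟨Q, h₁, h₂⟩ := ih h'
      exact ⟨.app K Q, Compat.rtc_app .refl h₁, reflGen_map _ h₂ fun _ _ => .appR⟩
    | appL h' => exact ⟨_, .single (.appL h'), .single (.appR h)⟩

/-! ### Confluence of β via parallel reduction -/

/-- Parallel β-reduction. -/
inductive Par : Lam → Lam → Prop
  | var (n : Nat) : Par (.var n) (.var n)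
  | lam {M M' : Lam} : Par M M' → Par (.lam M) (.lam M')
  | app {M M' N N' : Lam} : Par M M' → Par N N' → Par (.app M N) (.app M' N')
  | beta {M M' N N' : Lam} : Par M M' → Par N N' → Par (.app (.lam M) N) (M'.subst 0 N')

theorem Par.refl (M : Lam) : Par M M := by
  induction M with
  | var n => exact .var n
  | lam _ ih => exact .lam ih
  | app _ _ ih ih' => exact .app ih ih'

theorem Beta.par {M N : Lam} (h : Beta M N) : Par M N := by
  induction h with
  | contr h => obtain ⟨M, N⟩ := h; exact .beta (.refl _) (.refl _)
  | lam _ ih => exact .lam ih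
  | appL _ ih => exact .app ih (.refl _)
  | appR _ ih => exact .app (.refl _) ih

theorem Par.rtc_beta {M N : Lam} (h : Par M N) : Relation.ReflTransGen Beta M N := by
  induction h with
  | var n => exact .refl
  | lam _ ih => exact Compat.rtc_lam ih
  | app _ _ ih ih' => exact Compat.rtc_app ih ih'
  | beta _ _ ih ih' => exact (Compat.rtc_app (Compat.rtc_lam ih) ih').tail (.contr ⟨_, _⟩)

theorem Par.lift {M N : Lam} (h : Par M N) (d : Nat) : Par (M.lift d) (N.lift d) := by
  induction h generalizing d with
  | var n => exact .refl _
  | lam _ ih => exact .lam (ih _)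
  | app _ _ ih ih' => exact .app (ih _) (ih' _)
  | beta _ _ ih ih' =>
    rw [lift_subst_of_ge _ _ (Nat.zero_le d)]
    exact .beta (ih _) (ih' _)

theorem Par.subst {M M' N N' : Lam} (h : Par M M') (h' : Par N N') (x : Nat) :
    Par (M.subst x N) (M'.subst x N') := by
  induction h generalizing x N N' with
  | var n =>
    simp only [Lam.subst]
    split_ifs
    exacts [h', .refl _, .refl _]
  | lam _ ih => exact .lam (ih (h'.lift 0) _)
  | app _ _ ih₁ ih₂ => exact .app (ih₁ h' _) (ih₂ h' _)
  | beta _ _ ih₁ ih₂ =>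
    rw [subst_subst _ _ _ (Nat.zero_le x)]
    exact .beta (ih₁ (h'.lift 0) _) (ih₂ h' _)

/-- Complete development: contract all β-redexes of a term at once. -/
def dev : Lam → Lam
  | .var n => .var n
  | .lam M => .lam (dev M)
  | .app (.lam M) N => (dev M).subst 0 (dev N)
  | .app M N => .app (dev M) (dev N)

theorem Par.par_dev {M N : Lam} (h : Par M N) : Par N M.dev := by
  induction h with
  | var n => exact .var n
  | lam _ ih => exact .lam ih
  | @app M _ _ _ h _ ih ih' =>
    cases M with
    | lam M =>
      cases h with
      | lam h =>
        cases ih with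
        | lam ih => exact .beta ih ih'
    | _ => exact .app ih ih'
  | beta _ _ ih ih' => exact ih.subst ih' 0

theorem Beta.confluent {M N L : Lam} (h : Relation.ReflTransGen Beta M N)
    (h' : Relation.ReflTransGen Beta M L) :
    Relation.Join (Relation.ReflTransGen Beta) N L := by
  have toPar : ∀ {A B : Lam}, Relation.ReflTransGen Beta A B → Relation.ReflTransGen Par A B :=
    fun h => rtc_map id h fun _ _ h => Beta.par h
  have ofPar : ∀ {A B : Lam}, Relation.ReflTransGen Par A B → Relation.ReflTransGen Beta A B :=
    fun h => rtc_bind (f := id) h fun _ _ h => h.rtc_beta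
  obtain ⟨Q, h₁, h₂⟩ := Relation.church_rosser
    (fun a _ _ h h' => ⟨a.dev, .single h.par_dev, .single h'.par_dev⟩) (toPar h) (toPar h')
  exact ⟨Q, ofPar h₁, ofPar h₂⟩

theorem Eta.confluent {M N L : Lam} (h : Relation.ReflTransGen Eta M N)
    (h' : Relation.ReflTransGen Eta M L) :
    Relation.Join (Relation.ReflTransGen Eta) N L :=
  Relation.church_rosser (fun _ _ _ h h' =>
    let ⟨Q, h₁, h₂⟩ := Eta.subcommute h h'
    ⟨Q, h₁, h₂.to_reflTransGen⟩) h h'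

theorem rtc_beta_commute_rtc_eta {M N L : Lam} (h : Relation.ReflTransGen Beta M N)
    (h' : Relation.ReflTransGen Eta M L) :
    ∃ Q, Relation.ReflTransGen Eta N Q ∧ Relation.ReflTransGen Beta L Q := by
  have strip : ∀ {M N L : Lam}, Beta M N → Relation.ReflTransGen Eta M L →
      ∃ Q, Relation.ReflTransGen Eta N Q ∧ Relation.ReflGen Beta L Q := by
    intro M N L h h'
    induction h' with
    | refl => exact ⟨N, .refl, .single h⟩
    | tail _ h' ih =>
      obtain ⟨Q, h₁, h₂⟩ := ih
      cases h₂ with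
      | refl => exact ⟨_, h₁.tail h', .refl⟩
      | single h₂ =>
        obtain ⟨Q', h₃, h₄⟩ := Beta.commute_eta h₂ h'
        exact ⟨Q', h₁.trans h₃, h₄⟩
  induction h with
  | refl => exact ⟨L, h', .refl⟩
  | tail _ h ih =>
    obtain ⟨Q, h₁, h₂⟩ := ih
    obtain ⟨Q', h₃, h₄⟩ := strip h h₁
    exact ⟨Q', h₃, h₂.trans h₄.to_reflTransGen⟩

/-- Confluence of βη-reduction, by the Hindley–Rosen lemma. -/
theorem Steps.confluent {M N L : Lam} (h : Steps M N) (h' : Steps M L) :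
    ∃ Q, Steps N Q ∧ Steps L Q := by
  let R : Lam → Lam → Prop := fun a b =>
    Relation.ReflTransGen Beta a b ∨ Relation.ReflTransGen Eta a b
  have toR : ∀ {A B : Lam}, Steps A B → Relation.ReflTransGen R A B := fun h =>
    rtc_map id h fun _ _ h => (step_iff.1 h).imp .single .single
  have ofR : ∀ {A B : Lam}, Relation.ReflTransGen R A B → Steps A B := fun h =>
    rtc_bind (f := id) h fun _ _ h => h.elim
      (fun h => rtc_map id h fun _ _ h => step_iff.2 (.inl h))
      (fun h => rtc_map id h fun _ _ h => step_iff.2 (.inr h))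
  obtain ⟨Q, h₁, h₂⟩ := Relation.church_rosser (r := R) (by
    rintro a b c (hb | hb) (hc | hc)
    · obtain ⟨Q, h₁, h₂⟩ := Beta.confluent hb hc
      exact ⟨Q, .single (.inl h₁), .single (.inl h₂)⟩
    · obtain ⟨Q, h₁, h₂⟩ := rtc_beta_commute_rtc_eta hb hc
      exact ⟨Q, .single (.inr h₁), .single (.inl h₂)⟩
    · obtain ⟨Q, h₁, h₂⟩ := rtc_beta_commute_rtc_eta hc hb
      exact ⟨Q, .single (.inl h₂), .single (.inr h₁)⟩
    · obtain ⟨Q, h₁, h₂⟩ := Eta.confluent hb hc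
      exact ⟨Q, .single (.inr h₁), .single (.inr h₂)⟩) (toR h) (toR h')
  exact ⟨Q, ofR h₁, ofR h₂⟩

theorem Step.of_lift {M N : Lam} {d : Nat} (h : Step (M.lift d) N) :
    ∃ N' : Lam, N = N'.lift d ∧ Step M N' := by
  rcases step_iff.1 h with h | h
  · obtain ⟨N', e, h⟩ := Beta.of_lift h
    exact ⟨N', e, step_iff.2 (.inl h)⟩
  · obtain ⟨N', e, h⟩ := Eta.of_lift h
    exact ⟨N', e, step_iff.2 (.inr h)⟩

theorem Steps.lift {M N : Lam} (h : Steps M N) (d : Nat) : Steps (M.lift d) (N.lift d) :=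
  rtc_map (Lam.lift d) h fun _ _ h =>
    step_iff.2 ((step_iff.1 h).imp (Beta.lift · d) (Eta.lift · d))

theorem Steps.lam {M N : Lam} (h : Steps M N) : Steps (.lam M) (.lam N) :=
  rtc_map _ h fun _ _ => .lam

theorem Steps.app {M M' N N' : Lam} (h : Steps M M') (h' : Steps N N') :
    Steps (.app M N) (.app M' N') :=
  (rtc_map (Lam.app · N) h fun _ _ => .appL).trans (rtc_map (Lam.app M' ·) h' fun _ _ => .appR)

end Lam

/-! ### Substitution calculus of Λ$ -/

namespace Tm

theorem lift_lift (M : Tm) {i d : Nat} (h : i ≤ d) :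
    (M.lift i).lift (d + 1) = (M.lift d).lift i := by
  induction M generalizing i d with
  | var n => grind [lift]
  | lam M ih => simp only [lift, ih (Nat.succ_le_succ h)]
  | freeze M ih => simp only [lift, ih h]
  | app M N ihM ihN => simp only [lift, ihM h, ihN h]
  | thaw M ih => simp only [lift, ih h]

@[simp] theorem lift_zero_lift_succ (M : Tm) (d : Nat) :
    (M.lift 0).lift (d + 1) = (M.lift d).lift 0 := lift_lift M (Nat.zero_le d)

@[simp] theorem subst_lift_self (M N : Tm) (d : Nat) : (M.lift d).subst d N = M := by
  induction M generalizing d N with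
  | var n => grind [lift, subst]
  | lam M ih => simp only [lift, subst, ih]
  | freeze M ih => simp only [lift, subst, ih]
  | app M L ihM ihL => simp only [lift, subst, ihM, ihL]
  | thaw M ih => simp only [lift, subst, ih]

theorem lift_injective {M N : Tm} {d : Nat} (h : M.lift d = N.lift d) : M = N := by
  rw [← subst_lift_self M M d, h, subst_lift_self]

theorem lift_subst_of_le (M N : Tm) {i x : Nat} (h : i ≤ x) :
    (M.lift i).subst (x + 1) (N.lift i) = (M.subst x N).lift i := by
  induction M generalizing i x N with
  | var n => grind [lift, subst]
  | lam M ih =>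
    simp only [lift, subst, ← lift_lift N (Nat.zero_le i), ih _ (Nat.succ_le_succ h)]
  | freeze M ih => simp only [lift, subst, ih _ h]
  | app M L ihM ihL => simp only [lift, subst, ihM _ h, ihL _ h]
  | thaw M ih => simp only [lift, subst, ih _ h]

@[simp] theorem lift_zero_subst_succ (M N : Tm) (x : Nat) :
    (M.lift 0).subst (x + 1) (N.lift 0) = (M.subst x N).lift 0 :=
  lift_subst_of_le M N (Nat.zero_le x)

theorem exists_of_lift_eq_lift {M N : Tm} {i d : Nat} (h : i ≤ d)
    (e : M.lift (d + 1) = N.lift i) : ∃ K : Tm, M = K.lift i ∧ N = K.lift d := by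
  induction M generalizing N i d with
  | var n =>
    cases N with
    | var m =>
      refine ⟨.var (if n < i then n else n - 1), ?_⟩
      grind [lift]
    | _ => grind [lift]
  | lam M ih =>
    cases N with
    | lam N =>
      obtain ⟨K, rfl, rfl⟩ := ih (Nat.succ_le_succ h) (Tm.lam.inj e)
      exact ⟨.lam K, rfl, rfl⟩
    | _ => grind [lift]
  | freeze M ih =>
    cases N with
    | freeze N =>
      obtain ⟨K, rfl, rfl⟩ := ih h (Tm.freeze.inj e)
      exact ⟨.freeze K, rfl, rfl⟩
    | _ => grind [lift]
  | app M L ihM ihL =>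
    cases N with
    | app N O =>
      obtain ⟨eM, eL⟩ := Tm.app.inj e
      obtain ⟨K, rfl, rfl⟩ := ihM h eM
      obtain ⟨K', rfl, rfl⟩ := ihL h eL
      exact ⟨.app K K', rfl, rfl⟩
    | _ => grind [lift]
  | thaw M ih =>
    cases N with
    | thaw N =>
      obtain ⟨K, rfl, rfl⟩ := ih h (Tm.thaw.inj e)
      exact ⟨.thaw K, rfl, rfl⟩
    | _ => grind [lift]

@[simp] theorem isVal_var (n : Nat) : (Tm.var n).isVal = true := rfl

@[simp] theorem isVal_lam (M : Tm) : (Tm.lam M).isVal = true := rfl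

@[simp] theorem isVal_freeze (M : Tm) : (Tm.freeze M).isVal = true := rfl

@[simp] theorem isVal_app (M N : Tm) : (Tm.app M N).isVal = false := rfl

@[simp] theorem isVal_thaw (M : Tm) : (Tm.thaw M).isVal = false := rfl

theorem isValue_iff {M : Tm} : M.IsValue ↔ M.isVal = true := by
  constructor
  · rintro ⟨⟩ <;> rfl
  · cases M
    all_goals first | exact fun _ => by constructor | exact fun h => nomatch h

theorem isNonvalue_iff {M : Tm} : M.IsNonvalue ↔ M.isVal = false := by
  constructor
  · rintro ⟨⟩ <;> rfl
  · cases M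
    all_goals first | exact fun _ => by constructor | exact fun h => nomatch h

@[simp] theorem isVal_lift (M : Tm) (d : Nat) : (M.lift d).isVal = M.isVal := by
  cases M
  case var n => simp only [lift]; split <;> rfl
  all_goals rfl

theorem isVal_subst (M : Tm) {N : Tm} (h : N.isVal = true) (x : Nat) :
    (M.subst x N).isVal = M.isVal := by
  cases M
  case var n => simp only [subst]; split_ifs <;> first | rfl | exact h
  all_goals rfl

/-- Size of a Λ$-term. -/
def size : Tm → Nat
  | .var _ => 1
  | .lam M => size M + 1
  | .freeze M => size M + 1
  | .app M N => size M + size N + 1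
  | .thaw M => size M + 1

@[simp] theorem size_lift (M : Tm) (d : Nat) : (M.lift d).size = M.size := by
  induction M generalizing d with
  | var n => simp only [lift]; split <;> rfl
  | _ => simp_all [lift, size]

theorem IsNonvalue.one_lt_size {M : Tm} (h : M.IsNonvalue) : 1 < M.size := by
  have pos : ∀ M : Tm, 0 < M.size := by
    intro M
    cases M <;> simp [size]
  obtain ⟨M, N⟩ | ⟨M⟩ := h
  · simp [size, pos M]
  · simp [size, pos M]

theorem Steps.lam {M N : Tm} (h : Steps M N) : Steps (.lam M) (.lam N) :=
  rtc_map _ h fun _ _ => .lam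

theorem Steps.freeze {M N : Tm} (h : Steps M N) : Steps (.freeze M) (.freeze N) :=
  rtc_map _ h fun _ _ => .freeze

theorem Steps.thaw {M N : Tm} (h : Steps M N) : Steps (.thaw M) (.thaw N) :=
  rtc_map _ h fun _ _ => .thaw

theorem Steps.app {M M' N N' : Tm} (h : Steps M M') (h' : Steps N N') :
    Steps (.app M N) (.app M' N') :=
  (rtc_map (Tm.app · N) h fun _ _ => .appL).trans (rtc_map (Tm.app M' ·) h' fun _ _ => .appR)

theorem Contr.steps {M N : Tm} (h : Contr M N) : Steps M N := .single (.contr h)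

end Tm

/-! ### The CPS translation is monotone -/

/-- The CPS translation of `let x = P in N` in terms of those of `P` and `N`. -/
def cpsLet (A B : Lam) : Lam :=
  .lam (.app (A.lift 0) (.lam (.app (B.lift 1) (.var 1))))

theorem cps_of_isVal {V : Tm} (h : V.isVal = true) :
    cps V = .lam (.app (.var 0) ((cpsV V).lift 0)) := by
  cases V <;> simp_all [cps, cpsV, Lam.lift]

theorem cps_lift_and (M : Tm) (d : Nat) :
    cps (M.lift d) = (cps M).lift d ∧
      (M.isVal = true → cpsV (M.lift d) = (cpsV M).lift d) := by
  induction M generalizing d with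
  | var n =>
    simp only [Tm.lift]
    split_ifs <;> simp_all [cps, cpsV, Lam.lift]
  | lam M ih =>
    have h : cpsV ((Tm.lam M).lift d) = (cpsV (.lam M)).lift d := by
      simp [cpsV, Tm.lift, Lam.lift, ih]
    refine ⟨?_, fun _ => h⟩
    rw [cps_of_isVal (V := (Tm.lam M).lift d) rfl, h, cps_of_isVal rfl]
    simp [Lam.lift]
  | freeze M ih => simp [cps, cpsV, Tm.lift, Lam.lift, ih]
  | app M N ihM ihN =>
    refine ⟨?_, fun h => nomatch h⟩
    cases hM : M.isVal <;> cases hN : N.isVal <;>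
      simp [cps, Tm.lift, Lam.lift, hM, hN, ihM, ihN]
  | thaw M ih =>
    refine ⟨?_, fun h => nomatch h⟩
    cases hM : M.isVal <;> simp [cps, Tm.lift, Lam.lift, hM, ih]

@[simp] theorem cps_lift (M : Tm) (d : Nat) : cps (M.lift d) = (cps M).lift d :=
  (cps_lift_and M d).1

theorem cpsV_lift {M : Tm} (h : M.isVal = true) (d : Nat) :
    cpsV (M.lift d) = (cpsV M).lift d :=
  (cps_lift_and M d).2 h

theorem cps_subst_and (M : Tm) {V : Tm} (hV : V.isVal = true) (x : Nat) :
    cps (M.subst x V) = (cps M).subst x (cpsV V) ∧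
      (M.isVal = true → cpsV (M.subst x V) = (cpsV M).subst x (cpsV V)) := by
  have hV' : (V.lift 0).isVal = true := by simpa using hV
  induction M generalizing x V with
  | var n =>
    simp only [Tm.subst]
    split_ifs with h₁ h₂
    · subst h₁
      simp [cps_of_isVal hV, cps, cpsV, Lam.subst]
    · simp [cps, cpsV, Lam.subst, h₁, h₂]
    · have : n - 1 + 1 = n := by omega
      simp [cps, cpsV, Lam.subst, h₁, h₂, this]
  | lam M ih =>
    have h : cpsV ((Tm.lam M).subst x V) = (cpsV (.lam M)).subst x (cpsV V) := by
      simp [cpsV, Tm.subst, Lam.subst, ih, hV', cpsV_lift hV]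
    refine ⟨?_, fun _ => h⟩
    rw [cps_of_isVal (V := (Tm.lam M).subst x V) rfl, h, cps_of_isVal rfl]
    simp [Lam.subst]
  | freeze M ih => simp [cps, cpsV, Tm.subst, Lam.subst, ih, hV, hV']
  | app M N ihM ihN =>
    refine ⟨?_, fun h => nomatch h⟩
    cases hM : M.isVal <;> cases hN : N.isVal <;>
      simp [cps, Tm.subst, Lam.subst, hM, hN, ihM, ihN, hV, Tm.isVal_subst _ hV]
  | thaw M ih =>
    refine ⟨?_, fun h => nomatch h⟩
    cases hM : M.isVal <;> simp [cps, Tm.subst, Lam.subst, hM, ih, hV, Tm.isVal_subst _ hV]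

theorem cps_subst (M : Tm) {V : Tm} (hV : V.isVal = true) (x : Nat) :
    cps (M.subst x V) = (cps M).subst x (cpsV V) :=
  (cps_subst_and M hV x).1

theorem cps_plug {J : JCtx} {P : Tm} (hJ : J.Wf) (hP : P.isVal = false) :
    cps (J.plug P) = cpsLet (cps P) (cps ((J.lift 0).plug (.var 0))) := by
  cases J with
  | appL N =>
    cases hN : N.isVal <;>
      simp [cps, cpsV, cpsLet, JCtx.plug, JCtx.lift, hP, hN, Lam.lift, cpsV_lift]
  | appR V =>
    have hV := Tm.isValue_iff.1 hJ
    simp [cps, cpsV, cpsLet, JCtx.plug, JCtx.lift, hP, hV, Lam.lift, cpsV_lift]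
  | thaw => simp [cps, cpsV, cpsLet, JCtx.plug, JCtx.lift, hP, Lam.lift]

theorem cps_letIn (P N : Tm) : cps (Tm.letIn P N) = cpsLet (cps P) (cps N) := by
  simp [Tm.letIn, Tm.dol, cps, cpsV, cpsLet]

theorem cpsLet_steps {A A' B B' : Lam} (hA : A.Steps A') (hB : B.Steps B') :
    (cpsLet A B).Steps (cpsLet A' B') :=
  .lam (.app (hA.lift 0) (.lam (.app (hB.lift 1) .refl)))

theorem cpsLet_steps_subst {V : Tm} (hV : V.isVal = true) (N : Tm) :
    (cpsLet (cps V) (cps N)).Steps (cps (N.subst 0 V)) := by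
  rw [cps_subst N hV, cps_of_isVal hV]
  set U := cpsV V
  set B := cps N
  have h₁ : (cpsLet (.lam (.app (.var 0) (U.lift 0))) B).Step
      (.lam (.app (.lam (.app (B.lift 1) (.var 1))) (U.lift 0))) := by
    have := Lam.Contr.beta (.app (.var 0) ((U.lift 0).lift 0)) (.lam (.app (B.lift 1) (.var 1)))
    simp only [Lam.subst, Lam.subst_lift_self, if_true] at this
    simpa [cpsLet, Lam.lift] using Lam.Step.lam (.contr this)
  have h₂ : (Lam.lam (.app (.lam (.app (B.lift 1) (.var 1))) (U.lift 0))).Step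
      (.lam (.app ((B.subst 0 U).lift 0) (.var 0))) := by
    have := Lam.Contr.beta (.app (B.lift 1) (.var 1)) (U.lift 0)
    rw [Lam.lift_subst_of_ge _ _ le_rfl]
    simpa [Lam.subst] using Lam.Step.lam (.contr this)
  exact ((Relation.ReflTransGen.single h₁).tail h₂).tail (.contr (.eta _))

/-- Reducibility of the CPS translations, including those of the value parts. -/
def CpsSteps (M N : Tm) : Prop :=
  (cps M).Steps (cps N) ∧ (M.isVal = true → N.isVal = true ∧ (cpsV M).Steps (cpsV N))

namespace CpsSteps

theorem of_isVal {V W : Tm} (hV : V.isVal = true) (hW : W.isVal = true)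
    (h : (cpsV V).Steps (cpsV W)) : CpsSteps V W := by
  refine ⟨?_, fun _ => ⟨hW, h⟩⟩
  rw [cps_of_isVal hV, cps_of_isVal hW]
  exact .lam (.app .refl (h.lift 0))

theorem of_not_isVal {P N : Tm} (hP : P.isVal = false) (h : (cps P).Steps (cps N)) :
    CpsSteps P N :=
  ⟨h, fun hP' => by simp [hP] at hP'⟩

theorem lift {M N : Tm} (h : CpsSteps M N) (d : Nat) : CpsSteps (M.lift d) (N.lift d) := by
  refine ⟨by simpa using h.1.lift d, fun hM => ?_⟩
  rw [Tm.isVal_lift] at hM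
  obtain ⟨hN, h⟩ := h.2 hM
  rw [cpsV_lift hM, cpsV_lift hN, Tm.isVal_lift]
  exact ⟨hN, h.lift d⟩

theorem plug_nonvalue {J : JCtx} {P N : Tm} (hJ : J.Wf) (hP : P.isVal = false)
    (h : CpsSteps P N) (hsubst : ((J.lift 0).plug (.var 0)).subst 0 N = J.plug N) :
    (cps (J.plug P)).Steps (cps (J.plug N)) := by
  rw [cps_plug hJ hP]
  refine (cpsLet_steps h.1 .refl).trans ?_
  cases hN : N.isVal with
  | false => rw [cps_plug hJ hN]
  | true =>
    rw [← hsubst]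
    exact cpsLet_steps_subst hN _

theorem app_left {M N : Tm} (L : Tm) (h : CpsSteps M N) : CpsSteps (.app M L) (.app N L) := by
  refine of_not_isVal rfl ?_
  cases hM : M.isVal with
  | false =>
    exact plug_nonvalue (J := .appL L) trivial hM h
      (by simp [JCtx.plug, JCtx.lift, Tm.subst])
  | true =>
    obtain ⟨hN, h⟩ := h.2 hM
    cases hL : L.isVal
    · simp only [cps, hM, hN, hL, if_true, Bool.false_eq_true, if_false]
      exact .lam (.app .refl (.lam (.app (.app ((h.lift 0).lift 0) .refl) .refl)))
    · simp only [cps, hM, hN, hL, if_true]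
      exact .app h .refl

theorem app_right_of_isVal {V M N : Tm} (hV : V.isVal = true) (h : CpsSteps M N) :
    CpsSteps (.app V M) (.app V N) := by
  refine of_not_isVal rfl ?_
  cases hM : M.isVal with
  | false =>
    exact plug_nonvalue (J := .appR V) (Tm.isValue_iff.2 hV) hM h
      (by simp [JCtx.plug, JCtx.lift, Tm.subst])
  | true =>
    obtain ⟨hN, h⟩ := h.2 hM
    simp only [cps, hV, hM, hN, if_true]
    exact .app .refl h

theorem app_right {M N : Tm} (L : Tm) (h : CpsSteps M N) : CpsSteps (.app L M) (.app L N) := by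
  cases hL : L.isVal with
  | true => exact app_right_of_isVal hL h
  | false =>
    refine of_not_isVal rfl ?_
    have hM := cps_plug (J := .appL M) trivial hL
    have hN := cps_plug (J := .appL N) trivial hL
    simp only [JCtx.plug] at hM hN
    rw [hM, hN]
    exact cpsLet_steps .refl (app_right_of_isVal rfl (h.lift 0)).1

theorem thaw {M N : Tm} (h : CpsSteps M N) : CpsSteps (.thaw M) (.thaw N) := by
  refine of_not_isVal rfl ?_
  cases hM : M.isVal with
  | false =>
    exact plug_nonvalue (J := .thaw) trivial hM h
      (by simp [JCtx.plug, JCtx.lift, Tm.subst])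
  | true =>
    obtain ⟨hN, h⟩ := h.2 hM
    simpa only [cps, hM, hN, if_true] using h

theorem of_contr {M N : Tm} (h : Tm.Contr M N) : CpsSteps M N := by
  cases h with
  | betav M V hV =>
    rw [Tm.isValue_iff] at hV
    refine of_not_isVal rfl ?_
    rw [cps_subst M hV]
    simp only [cps, cpsV, Tm.isVal_lam, hV, if_true]
    exact .single (.contr (.beta _ _))
  | etav V hV =>
    rw [Tm.isValue_iff] at hV
    refine of_isVal rfl hV ?_
    simp only [cps, cpsV, Tm.isVal_lift, Tm.isVal_var, hV, if_true, cpsV_lift hV]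
    exact .single (.contr (.eta _))
  | dolv V hV =>
    rw [Tm.isValue_iff] at hV
    refine of_isVal rfl rfl ?_
    simp only [cps, cpsV, Tm.isVal_lift, Tm.isVal_var, hV, if_true, cpsV_lift hV, cps_of_isVal hV]
    exact .refl
  | dolsh V hV =>
    rw [Tm.isValue_iff] at hV
    refine of_isVal rfl hV ?_
    simp only [cps, cpsV, hV, if_true]
    exact .refl
  | shdol M =>
    refine of_not_isVal rfl ?_
    simp only [cps, cpsV, Tm.isVal_freeze, if_true]
    exact .refl
  | pure V hV =>
    rw [Tm.isValue_iff] at hV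
    refine of_not_isVal rfl ?_
    simp only [cps, cpsV, Tm.isVal_lift, Tm.isVal_var, hV, if_true, cpsV_lift hV, cps_of_isVal hV]
    exact .refl
  | bind J P hJ hP =>
    rw [Tm.isNonvalue_iff] at hP
    refine of_not_isVal (by cases J <;> rfl) ?_
    rw [cps_plug hJ hP, cps_letIn]
    exact .refl

theorem of_step {M N : Tm} (h : M.Step N) : CpsSteps M N := by
  induction h with
  | contr h => exact of_contr h
  | lam _ ih => exact of_isVal rfl rfl (by simpa only [cpsV] using ih.1.lam)
  | freeze _ ih => exact of_isVal rfl rfl (by simpa only [cpsV] using ih.1)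
  | appL _ ih => exact ih.app_left _
  | appR _ ih => exact ih.app_right _
  | thaw _ ih => exact ih.thaw

end CpsSteps

theorem cps_steps {M N : Tm} (h : M.Steps N) : (cps M).Steps (cps N) :=
  rtc_bind h fun _ _ h => (CpsSteps.of_step h).1

/-! ### A direct-style translation that is monotone -/

open Classical in
/-- Thawing a value, simplified by the contractions for thaw. -/
noncomputable def thawOpt : Tm → Tm
  | .freeze M => M
  | .lam M => if h : ∃ V : Tm, V.IsValue ∧ M = .app (.var 0) (V.lift 0) then h.choose
      else .thaw (.lam M)
  | M => .thaw M

@[simp] theorem thawOpt_var (n : Nat) : thawOpt (.var n) = .thaw (.var n) := rfl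

@[simp] theorem thawOpt_freeze (M : Tm) : thawOpt (.freeze M) = M := rfl

theorem thawOpt_pure {V : Tm} (hV : V.IsValue) :
    thawOpt (.lam (.app (.var 0) (V.lift 0))) = V := by
  have h : ∃ W : Tm, W.IsValue ∧ Tm.app (.var 0) (V.lift 0) = .app (.var 0) (W.lift 0) :=
    ⟨V, hV, rfl⟩
  rw [thawOpt, dif_pos h]
  exact (Tm.lift_injective (Tm.app.inj h.choose_spec.2).2).symm

theorem thawOpt_lam (M : Tm) :
    (∃ V : Tm, V.IsValue ∧ M = .app (.var 0) (V.lift 0) ∧ thawOpt (.lam M) = V) ∨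
      thawOpt (.lam M) = .thaw (.lam M) := by
  by_cases h : ∃ V : Tm, V.IsValue ∧ M = .app (.var 0) (V.lift 0)
  · obtain ⟨V, hV, rfl⟩ := h
    exact .inl ⟨V, hV, rfl, thawOpt_pure hV⟩
  · exact .inr (by rw [thawOpt, dif_neg h])

theorem thaw_steps_thawOpt {V : Tm} (hV : V.IsValue) : (Tm.thaw V).Steps (thawOpt V) := by
  obtain ⟨n⟩ | ⟨M⟩ | ⟨M⟩ := hV
  · exact .refl
  · obtain ⟨W, hW, rfl, e⟩ | e := thawOpt_lam M
    · rw [e]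
      exact (Tm.Contr.pure W hW).steps
    · rw [e]
      exact .refl
  · exact (Tm.Contr.shdol M).steps

theorem freeze_thawOpt_steps {V : Tm} (hV : V.IsValue) : (Tm.freeze (thawOpt V)).Steps V := by
  obtain ⟨n⟩ | ⟨M⟩ | ⟨M⟩ := hV
  · exact (Tm.Contr.dolsh _ (.var n)).steps
  · obtain ⟨W, hW, rfl, e⟩ | e := thawOpt_lam M
    · rw [e]
      exact (Tm.Contr.dolv W hW).steps
    · rw [e]
      exact (Tm.Contr.dolsh _ (.lam M)).steps
  · exact .refl

theorem exists_of_thawOpt_eq_lift {V M : Tm} {d : Nat} (hV : V.IsValue)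
    (e : thawOpt V = M.lift d) : ∃ W : Tm, V = W.lift d := by
  have thaw : ∀ {V : Tm}, .thaw V = M.lift d → ∃ W : Tm, V = W.lift d := by
    intro V e
    cases M with
    | thaw W => exact ⟨W, Tm.thaw.inj e⟩
    | _ => grind [Tm.lift]
  obtain ⟨n⟩ | ⟨N⟩ | ⟨N⟩ := hV
  · exact thaw e
  · obtain ⟨W, hW, rfl, e'⟩ | e' := thawOpt_lam N
    · refine ⟨.lam (.app (.var 0) (M.lift 0)), ?_⟩
      simp [Tm.lift, ← e, e']
    · exact thaw (e' ▸ e)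
  · exact ⟨.freeze M, by simp [Tm.lift, ← e]⟩

theorem thawOpt_lift {V : Tm} (hV : V.IsValue) (d : Nat) :
    thawOpt (V.lift d) = (thawOpt V).lift d := by
  obtain ⟨n⟩ | ⟨M⟩ | ⟨M⟩ := hV
  · simp only [Tm.lift]
    split <;> simp_all [Tm.lift]
  · obtain ⟨W, hW, e, e'⟩ | e' := thawOpt_lam (M.lift (d + 1))
    · cases M with
      | app M N =>
        obtain ⟨e₁, e₂⟩ := Tm.app.inj e
        obtain ⟨K, rfl, rfl⟩ := Tm.exists_of_lift_eq_lift (Nat.zero_le d) e₂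
        have hK : K.IsValue := by simpa [Tm.isValue_iff] using hW
        obtain rfl : M = .var 0 := by
          cases M <;> grind [Tm.lift]
        rw [thawOpt_pure hK]
        exact e'
      | _ => grind [Tm.lift]
    · obtain ⟨W, hW, rfl, e⟩ | e := thawOpt_lam M
      · rw [e]
        have hW' : (W.lift d).IsValue := by simpa [Tm.isValue_iff] using hW
        simpa [Tm.lift] using thawOpt_pure hW'
      · rw [e]
        exact e'
  · rfl

/-- The part of the direct-style translation that yields values. -/
noncomputable def valDirect : Lam → Tm
  | .var n => .var n
  | .lam M => .lam (thawOpt (valDirect M))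
  | .app M N => .freeze (.app (valDirect M) (valDirect N))

/-- The direct-style translation of CPS terms. -/
noncomputable def direct (M : Lam) : Tm := thawOpt (valDirect M)

theorem isValue_valDirect (M : Lam) : (valDirect M).IsValue := by
  cases M <;> constructor

@[simp] theorem valDirect_lift (M : Lam) (d : Nat) :
    valDirect (M.lift d) = (valDirect M).lift d := by
  induction M generalizing d with
  | var n => simp only [Lam.lift, valDirect, Tm.lift]; split <;> rfl
  | lam M ih => simp only [Lam.lift, valDirect, Tm.lift, ih, thawOpt_lift (isValue_valDirect M)]
  | app M N ihM ihN => simp only [Lam.lift, valDirect, Tm.lift, ihM, ihN]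

theorem exists_of_valDirect_eq_lift {M : Lam} {N : Tm} {d : Nat}
    (e : valDirect M = N.lift d) : ∃ K : Lam, M = K.lift d := by
  induction M generalizing N d with
  | var n =>
    cases N with
    | var m =>
      refine ⟨.var m, ?_⟩
      grind [Lam.lift, Tm.lift, valDirect]
    | _ => grind [Tm.lift, valDirect]
  | lam M ih =>
    cases N with
    | lam N =>
      obtain ⟨W, e⟩ := exists_of_thawOpt_eq_lift (isValue_valDirect M) (Tm.lam.inj e)
      obtain ⟨K, rfl⟩ := ih e
      exact ⟨.lam K, rfl⟩
    | _ => grind [Tm.lift, valDirect]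
  | app M L ihM ihL =>
    cases N with
    | freeze N =>
      have e := Tm.freeze.inj e
      cases N with
      | app N O =>
        obtain ⟨e₁, e₂⟩ := Tm.app.inj e
        obtain ⟨K, rfl⟩ := ihM e₁
        obtain ⟨K', rfl⟩ := ihL e₂
        exact ⟨.app K K', rfl⟩
      | _ => grind [Tm.lift]
    | _ => grind [Tm.lift, valDirect]

theorem freeze_direct_steps (M : Lam) : (Tm.freeze (direct M)).Steps (valDirect M) :=
  freeze_thawOpt_steps (isValue_valDirect M)

theorem thaw_valDirect_steps (M : Lam) : (Tm.thaw (valDirect M)).Steps (direct M) :=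
  thaw_steps_thawOpt (isValue_valDirect M)

theorem direct_pure (M : Lam) : direct (.lam (.app (.var 0) (M.lift 0))) = valDirect M := by
  simpa [direct, valDirect] using thawOpt_pure (isValue_valDirect M)

/-- A translated abstraction is simplified only if it is of the form `λk.k N` with `k` not
free in `N`. -/
theorem direct_lam (M : Lam) :
    (∃ N : Lam, M = .app (.var 0) (N.lift 0)) ∨
      direct (.lam M) = .thaw (valDirect (.lam M)) := by
  obtain ⟨V, -, e, -⟩ | e := thawOpt_lam (direct M)
  · left
    cases M with
    | var n => nomatch e
    | app M N =>
      obtain ⟨e₁, e₂⟩ := Tm.app.inj e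
      obtain ⟨K, rfl⟩ := exists_of_valDirect_eq_lift e₂
      cases M with
      | var n => exact ⟨K, by simpa [valDirect] using e₁⟩
      | _ => simp [valDirect] at e₁
    | lam M =>
      have e : thawOpt (.lam (direct M)) = .app (.var 0) (V.lift 0) := e
      obtain ⟨W, hW, -, e'⟩ | e' := thawOpt_lam (direct M)
      · rw [e'] at e
        subst e
        cases hW
      · rw [e'] at e
        nomatch e
  · exact .inr e

theorem valDirect_subst_and (M N : Lam) (x : Nat) :
    ((valDirect M).subst x (valDirect N)).Steps (valDirect (M.subst x N)) ∧
      ((direct M).subst x (valDirect N)).Steps (direct (M.subst x N)) := by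
  induction hn : M.size using Nat.strong_induction_on generalizing M N x with
  | _ n ih =>
    subst hn
    cases M with
    | var n =>
      simp only [Lam.subst, valDirect, direct, thawOpt_var, Tm.subst]
      split_ifs
      · exact ⟨.refl, thaw_valDirect_steps N⟩
      · exact ⟨.refl, .refl⟩
      · exact ⟨.refl, .refl⟩
    | app M L =>
      have h := Tm.Steps.app (ih M.size (by simp [Lam.size, Nat.add_assoc]) M N x rfl).1
        (ih L.size (by simp [Lam.size]) L N x rfl).1
      exact ⟨h.freeze, h⟩
    | lam M =>
      have h : ((valDirect (.lam M)).subst x (valDirect N)).Steps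
          (valDirect ((Lam.lam M).subst x N)) := by
        simpa only [Lam.subst, valDirect, direct, Tm.subst, valDirect_lift] using
          (ih M.size (by simp [Lam.size]) M (N.lift 0) (x + 1) rfl).2.lam
      refine ⟨h, ?_⟩
      obtain ⟨L, rfl⟩ | e := direct_lam M
      · have h := (ih L.size (by simp [Lam.size]; omega) L N x rfl).1
        rw [direct_pure]
        simpa [Lam.subst, direct_pure] using h
      · rw [e]
        exact h.thaw.trans (thaw_valDirect_steps _)

/-- Translating a contraction. -/
theorem direct_contr {M N : Lam} (h : Lam.Contr M N) :
    (direct M).Steps (direct N) ∧ (valDirect M).Steps (valDirect N) := by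
  cases h with
  | beta M N =>
    have h : (direct (.app (.lam M) N)).Steps (direct (M.subst 0 N)) :=
      (Tm.Contr.betav (direct M) _ (isValue_valDirect N)).steps.trans
        (valDirect_subst_and M N 0).2
    exact ⟨h, h.freeze.trans (freeze_direct_steps _)⟩
  | eta =>
    have h : (valDirect (.lam (.app (N.lift 0) (.var 0)))).Steps (valDirect N) := by
      simpa [valDirect] using (Tm.Contr.etav _ (isValue_valDirect N)).steps
    refine ⟨?_, h⟩
    obtain ⟨L, e⟩ | e := direct_lam (.app (N.lift 0) (.var 0))
    · cases L <;> grind [Lam.lift]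
    · rw [e]
      exact h.thaw.trans (thaw_valDirect_steps _)

theorem direct_step {M N : Lam} (h : M.Step N) :
    (direct M).Steps (direct N) ∧ (valDirect M).Steps (valDirect N) := by
  induction hn : M.size using Nat.strong_induction_on generalizing M N with
  | _ n ih =>
    subst hn
    cases h with
    | contr h => exact direct_contr h
    | @lam M N h =>
      have h' : (valDirect (.lam M)).Steps (valDirect (.lam N)) :=
        (ih _ (by simp [Lam.size]) h rfl).1.lam
      refine ⟨?_, h'⟩
      obtain ⟨L, rfl⟩ | e := direct_lam M
      · cases h with
        | contr h => nomatch h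
        | appL h => cases h with | contr h => nomatch h
        | appR h =>
          obtain ⟨L', rfl, hL⟩ := h.of_lift
          rw [direct_pure, direct_pure]
          exact (ih L.size (by simp [Lam.size]; omega) hL rfl).2
      · rw [e]
        exact h'.thaw.trans (thaw_valDirect_steps _)
    | @appL M N L h =>
      have h := (ih _ (by simp [Lam.size, Nat.add_assoc]) h rfl).2.app
        (.refl : (valDirect L).Steps (valDirect L))
      exact ⟨h, h.freeze⟩
    | @appR M N L h =>
      have h := Tm.Steps.app (.refl : (valDirect L).Steps (valDirect L))
        (ih _ (by simp [Lam.size]) h rfl).2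
      exact ⟨h, h.freeze⟩

theorem direct_steps {M N : Lam} (h : M.Steps N) : (direct M).Steps (direct N) :=
  rtc_bind h fun _ _ h => (direct_step h).1

/-! ### Every term reduces to the direct-style translation of its CPS translation -/

theorem direct_cps_of_isVal {V : Tm} (h : V.isVal = true) :
    direct (cps V) = valDirect (cpsV V) := by
  rw [cps_of_isVal h, direct_pure]

theorem plug_steps_direct_cps {J : JCtx} {P : Tm} (hJ : J.Wf) (hP : P.IsNonvalue)
    (h₁ : (P.lift 0).Steps (direct (cps (P.lift 0))))
    (h₂ : (((J.lift 0).plug (.var 0)).lift 1).Steps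
      (direct (cps (((J.lift 0).plug (.var 0)).lift 1)))) :
    (J.plug P).Steps (direct (cps (J.plug P))) := by
  rw [cps_plug hJ (Tm.isNonvalue_iff.1 hP)]
  refine .head (.contr (.bind J P hJ hP)) ?_
  generalize (J.lift 0).plug (.var 0) = N at *
  have h : (Tm.lam (.app (.freeze (P.lift 0)) (.lam (.app (.freeze (N.lift 1)) (.var 1))))).Steps
      (valDirect (cpsLet (cps P) (cps N))) := by
    simpa [cpsLet, valDirect] using
      Tm.Steps.lam (.app (h₁.freeze.trans (freeze_direct_steps _))
        (.lam (.app (h₂.freeze.trans (freeze_direct_steps _)) .refl)))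
  exact h.thaw.trans (thaw_valDirect_steps _)

theorem steps_direct_cps (M : Tm) : M.Steps (direct (cps M)) := by
  induction hn : M.size using Nat.strong_induction_on generalizing M with
  | _ n ih =>
    subst hn
    have plug : ∀ {J : JCtx} {P : Tm}, J.Wf → P.IsNonvalue → M = J.plug P →
        M.Steps (direct (cps M)) := by
      rintro J P hJ hP rfl
      have := hP.one_lt_size
      refine plug_steps_direct_cps hJ hP (ih _ ?_ _ rfl) (ih _ ?_ _ rfl)
      all_goals
        rw [Tm.size_lift]
        cases J <;> simp [JCtx.plug, JCtx.lift, Tm.size] <;> omega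
    have value : ∀ {V : Tm}, V.isVal = true → V.size < M.size →
        V.Steps (valDirect (cpsV V)) :=
      fun hV h => direct_cps_of_isVal hV ▸ ih _ h _ rfl
    cases M with
    | var n =>
      rw [direct_cps_of_isVal rfl]
      exact .refl
    | lam M =>
      rw [direct_cps_of_isVal rfl]
      exact (ih M.size (by simp [Tm.size]) M rfl).lam
    | freeze M =>
      rw [direct_cps_of_isVal rfl]
      exact (ih M.size (by simp [Tm.size]) M rfl).freeze.trans (freeze_direct_steps _)
    | app M N =>
      cases hM : M.isVal with
      | false => exact plug (J := .appL N) trivial (Tm.isNonvalue_iff.2 hM) rfl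
      | true =>
        cases hN : N.isVal with
        | false => exact plug (J := .appR M) (Tm.isValue_iff.2 hM) (Tm.isNonvalue_iff.2 hN) rfl
        | true =>
          simp only [cps, hM, hN, if_true]
          exact .app (value hM (by simp [Tm.size, Nat.add_assoc])) (value hN (by simp [Tm.size]))
    | thaw M =>
      cases hM : M.isVal with
      | false => exact plug (J := .thaw) trivial (Tm.isNonvalue_iff.2 hM) rfl
      | true =>
        simp only [cps, hM, if_true]
        exact (value hM (by simp [Tm.size])).thaw.trans (thaw_valDirect_steps _)

/-- **Confluence of Λ$.**  For all Λ$-terms `M, M₁, M₂`, if `M ↠Λ$ M₁` and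
`M ↠Λ$ M₂`, then there exists `N` with `M₁ ↠Λ$ N` and `M₂ ↠Λ$ N`. -/
theorem lamdollar_confluent (M M₁ M₂ : Tm) (h₁ : M.Steps M₁) (h₂ : M.Steps M₂) :
    ∃ N : Tm, M₁.Steps N ∧ M₂.Steps N := by
  obtain ⟨L, hL₁, hL₂⟩ := (cps_steps h₁).confluent (cps_steps h₂)
  exact ⟨direct L, (steps_direct_cps M₁).trans (direct_steps hL₁),
    (steps_direct_cps M₂).trans (direct_steps hL₂)⟩

end Shift0
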